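/- Let α > 0 be a real number and let N be an integer with N > max{α + 2, 2α − 3}. Then for every u ∈ C_c^∞(ℍ^N∖{o}) one has ∫_{ℍ^N} (Δ_r u)²/r^{α−2} dv ≥ ((N−2−α)²(N−2+α)²/16) ∫_{ℍ^N} u²/r^{α+2} dv + ((N−2−α)(N−2+α)(N−1)/4) ∫_{ℍ^N} u²/r^α dv + ((N−1)(N−3−2α)(N−2−α)(N−2+α)/8) ∫_{ℍ^N} g(r) u²/r^α dv, where g(r) := (r coth(r) − 1)/r². -/

import Mathlib

open MeasureTheory Real Set

noncomputable section

/-- The radial derivative `∇_r u = ∂u/∂r` of a function `u(r,σ)`. -/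
def radGrad (N : ℕ) (u : ℝ → EuclideanSpace ℝ (Fin N) → ℝ) :
    ℝ → EuclideanSpace ℝ (Fin N) → ℝ :=
  fun r σ => deriv (fun s => u s σ) r

/-- The radial Laplacian `Δ_r u = ∂²u/∂r² + (N-1) coth r · ∂u/∂r`. -/
def radLap (N : ℕ) (u : ℝ → EuclideanSpace ℝ (Fin N) → ℝ) :
    ℝ → EuclideanSpace ℝ (Fin N) → ℝ :=
  fun r σ => deriv (fun s => deriv (fun t => u t σ) s) r
    + ((N : ℝ) - 1) * (Real.cosh r / Real.sinh r) * deriv (fun s => u s σ) r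

/-- The higher order radial derivative `∇_r^k u`: `Δ_r^{k/2} u` for even `k`,
`∂_r (Δ_r^{(k-1)/2} u)` for odd `k`. -/
def radPow (N k : ℕ) (u : ℝ → EuclideanSpace ℝ (Fin N) → ℝ) :
    ℝ → EuclideanSpace ℝ (Fin N) → ℝ :=
  if Even k then (radLap N)^[k / 2] u else radGrad N ((radLap N)^[k / 2] u)

/-- The integral over the hyperbolic space `ℍ^N` in polar coordinates:
`∫_{S^{N-1}} ∫_0^∞ F(r,σ) (sinh r)^{N-1} dr dσ`, where `dσ` is the standard
surface measure (the `(N-1)`-dimensional Hausdorff measure) on the unit sphere. -/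
def hypInt (N : ℕ) (F : ℝ → EuclideanSpace ℝ (Fin N) → ℝ) : ℝ :=
  ∫ σ in Metric.sphere (0 : EuclideanSpace ℝ (Fin N)) 1,
    (∫ r in Ioi (0 : ℝ), F r σ * Real.sinh r ^ (N - 1)) ∂μH[(N : ℝ) - 1]

/-- `u ∈ C_c^∞(ℍ^N)`: `u(r,σ)` smooth (including at the pole `r = 0`) and
vanishing for all `r` larger than some `R`. -/
def IsCc (N : ℕ) (u : ℝ → EuclideanSpace ℝ (Fin N) → ℝ) : Prop :=
  ContDiff ℝ (⊤ : ℕ∞) (Function.uncurry u) ∧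
  ∃ R : ℝ, ∀ r : ℝ, R < r → ∀ σ ∈ Metric.sphere (0 : EuclideanSpace ℝ (Fin N)) 1, u r σ = 0

/-- `u ∈ C_c^∞(ℍ^N \ {o})`: `u(r,σ)` smooth with support contained in
`[a,b] × S^{N-1}` for some `0 < a ≤ b`. -/
def IsCcAway (N : ℕ) (u : ℝ → EuclideanSpace ℝ (Fin N) → ℝ) : Prop :=
  ContDiff ℝ (⊤ : ℕ∞) (Function.uncurry u) ∧
  ∃ a b : ℝ, 0 < a ∧ a ≤ b ∧
    ∀ r : ℝ, r ∉ Icc a b → ∀ σ ∈ Metric.sphere (0 : EuclideanSpace ℝ (Fin N)) 1, u r σ = 0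

theorem hausdorffMeasure_sphere_lt_top (n : ℕ) :
    μH[(n : ℝ)] (Metric.sphere (0 : EuclideanSpace ℝ (Fin (n + 1))) 1) < ⊤ := by
  let x : Fin (n + 1) → ℝ → (Fin n → ℝ) → EuclideanSpace ℝ (Fin (n + 1)) :=
    fun i s y => WithLp.toLp 2 (i.insertNth s y)
  let f : Fin (n + 1) → ℝ → (Fin n → ℝ) → EuclideanSpace ℝ (Fin (n + 1)) :=
    fun i s y => ‖x i s y‖⁻¹ • x i s y
  let K : Set (Fin n → ℝ) := Icc (-1) 1
  have hx : ∀ i s, ContDiff ℝ 1 (x i s) := by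
    intro i s
    rw [contDiff_euclidean]
    intro j
    refine Fin.succAboveCases i ?_ (fun k => ?_) j
    · simpa [x] using contDiff_const
    · simpa [x] using contDiff_apply ℝ ℝ k
  have hx0 : ∀ i s, s ≠ 0 → ∀ y, x i s y ≠ 0 := by
    intro i s hs y h
    apply hs
    have := congrArg (fun v : EuclideanSpace ℝ (Fin (n + 1)) => v i) h
    simpa [x] using this
  have himage : ∀ i s, s ≠ 0 → μH[(n : ℝ)] (f i s '' K) < ⊤ := by
    intro i s hs
    have hf : ContDiff ℝ 1 (f i s) :=
      (((hx i s).norm ℝ (hx0 i s hs)).inv fun y => norm_ne_zero_iff.2 (hx0 i s hs y)).smul (hx i s)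
    obtain ⟨C, hC⟩ := hf.contDiffOn.exists_lipschitzOnWith one_ne_zero (convex_Icc _ _)
      (isCompact_Icc : IsCompact K)
    refine (hC.hausdorffMeasure_image_le n.cast_nonneg).trans_lt ?_
    have hK : μH[(n : ℝ)] K < ⊤ := by
      have h := hausdorffMeasure_pi_real (ι := Fin n)
      rw [Fintype.card_fin] at h
      rw [h]
      exact isCompact_Icc.measure_lt_top
    exact ENNReal.mul_lt_top (ENNReal.rpow_lt_top_of_nonneg n.cast_nonneg ENNReal.coe_ne_top) hK
  have hcover : Metric.sphere (0 : EuclideanSpace ℝ (Fin (n + 1))) 1 ⊆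
      ⋃ i, (f i 1 '' K ∪ f i (-1) '' K) := by
    intro σ hσ
    have hσ1 : ‖σ‖ = 1 := by simpa using hσ
    obtain ⟨i, -, hi⟩ := Finset.exists_max_image Finset.univ (fun j => |σ j|) ⟨0, Finset.mem_univ _⟩
    have hpos : 0 < |σ i| := by
      by_contra! h
      have : σ = 0 := by
        ext j
        exact abs_nonpos_iff.1 ((hi j (Finset.mem_univ _)).trans h)
      simp [this] at hσ1
    let y : Fin n → ℝ := fun j => |σ i|⁻¹ * σ (i.succAbove j)
    have hy : y ∈ K := by
      have : ∀ j, |y j| ≤ 1 := fun j => by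
        simp only [y, abs_mul, abs_inv, abs_abs]
        rw [inv_mul_le_one₀ hpos]
        exact hi _ (Finset.mem_univ _)
      exact ⟨fun j => (abs_le.1 (this j)).1, fun j => (abs_le.1 (this j)).2⟩
    have key : ∀ s, s * |σ i| = σ i → f i s y = σ := by
      intro s hs
      have hxs : x i s y = |σ i|⁻¹ • σ := by
        ext j
        refine Fin.succAboveCases i ?_ (fun k => ?_) j
        · simp only [x, Fin.insertNth_apply_same, PiLp.smul_apply, smul_eq_mul]
          rw [eq_inv_mul_iff_mul_eq₀ hpos.ne', mul_comm, hs]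
        · simp [x, y]
      simp only [f, hxs, norm_smul, hσ1, norm_inv, Real.norm_eq_abs, abs_abs, mul_one, inv_inv,
        smul_smul, mul_inv_cancel₀ hpos.ne', one_smul]
    refine mem_iUnion.2 ⟨i, ?_⟩
    rcases abs_choice (σ i) with h | h
    · exact Or.inl ⟨y, hy, key 1 (by rw [one_mul, h])⟩
    · exact Or.inr ⟨y, hy, key (-1) (by rw [h]; ring)⟩
  refine (measure_mono hcover).trans_lt ((measure_iUnion_le _).trans_lt ?_)
  rw [tsum_fintype]
  exact ENNReal.sum_lt_top.2 fun i _ => (measure_union_le _ _).trans_lt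
    (ENNReal.add_lt_top.2 ⟨himage i 1 one_ne_zero, himage i (-1) (by norm_num)⟩)

theorem integrableOn_and_integrableOn_integral {X : Type*} [TopologicalSpace X]
    [FirstCountableTopology X] [LocallyCompactSpace X] [MeasurableSpace X] [OpensMeasurableSpace X]
    [T2Space X] {μ : Measure X} {S : Set X} (hS : IsCompact S) (hμ : μ S ≠ ⊤)
    {F : ℝ → X → ℝ} {a b : ℝ} (ha : 0 < a)
    (hF : ContinuousOn (Function.uncurry F) (Ioi 0 ×ˢ univ))
    (hzero : ∀ r, 0 < r → r ∉ Icc a b → ∀ σ ∈ S, F r σ = 0) :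
    (∀ σ ∈ S, IntegrableOn (fun r => F r σ) (Ioi 0)) ∧
      IntegrableOn (fun σ => ∫ r in Ioi 0, F r σ) S μ := by
  have hsub : Icc a b ⊆ Ioi 0 := fun r hr => ha.trans_le hr.1
  constructor
  · intro σ hσ
    have hc : ContinuousOn (fun r => F r σ) (Icc a b) :=
      hF.comp (f := fun r => (r, σ)) (by fun_prop) fun r hr => ⟨hsub hr, mem_univ _⟩
    refine (hc.integrableOn_compact isCompact_Icc).of_forall_sdiff_eq_zero measurableSet_Ioi ?_
    exact fun r hr => hzero r hr.1 hr.2 σ hσ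
  · have hcont : Continuous (Function.uncurry fun (σ : X) (r : ℝ) => F (max r a) σ) := by
      have : Continuous fun p : X × ℝ => (max p.2 a, p.1) := by fun_prop
      exact hF.comp_continuous this fun p => ⟨ha.trans_le (le_max_right _ _), mem_univ _⟩
    have hint := continuous_parametric_integral_of_continuous (μ := volume) hcont
      (isCompact_Icc : IsCompact (Icc a b))
    have := hint.continuousOn.integrableOn_of_subset_isCompact hS hS.measurableSet subset_rfl hμ
    refine this.congr_fun (fun σ hσ => ?_) hS.measurableSet
    rw [setIntegral_eq_of_subset_of_forall_sdiff_eq_zero measurableSet_Ioi hsub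
      fun r hr => hzero r hr.1 hr.2 σ hσ]
    exact setIntegral_congr_fun measurableSet_Icc fun r hr => by simp [max_eq_left hr.1]

theorem contDiff_radGrad {N : ℕ} {u : ℝ → EuclideanSpace ℝ (Fin N) → ℝ}
    (hu : ContDiff ℝ (⊤ : ℕ∞) (Function.uncurry u)) :
    ContDiff ℝ (⊤ : ℕ∞) (Function.uncurry (radGrad N u)) := by
  have h : Function.uncurry (radGrad N u) =
      fun p => fderiv ℝ (Function.uncurry u) p ((1 : ℝ), (0 : EuclideanSpace ℝ (Fin N))) := by
    ext ⟨r, σ⟩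
    have hd : HasFDerivAt (Function.uncurry u) (fderiv ℝ (Function.uncurry u) (r, σ)) (r, σ) :=
      (hu.differentiable (by simp) _).hasFDerivAt
    have hp : HasDerivAt (fun s : ℝ => (s, σ)) ((1 : ℝ), (0 : EuclideanSpace ℝ (Fin N))) r :=
      (hasDerivAt_id r).prodMk (hasDerivAt_const r σ)
    exact (hd.comp_hasDerivAt r hp).deriv
  rw [h]
  exact (hu.fderiv_right (by simp)).clm_apply contDiff_const

theorem hasDerivAt_radGrad {N : ℕ} {u : ℝ → EuclideanSpace ℝ (Fin N) → ℝ}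
    (hu : ContDiff ℝ (⊤ : ℕ∞) (Function.uncurry u)) (r : ℝ) (σ : EuclideanSpace ℝ (Fin N)) :
    HasDerivAt (fun s => u s σ) (radGrad N u r σ) r := by
  have h : ContDiff ℝ (⊤ : ℕ∞) fun s => u s σ :=
    hu.comp (f := fun s : ℝ => (s, σ)) (contDiff_id.prodMk contDiff_const)
  exact (h.differentiable (by simp) r).hasDerivAt

theorem radGrad_eq_zero {N : ℕ} {u : ℝ → EuclideanSpace ℝ (Fin N) → ℝ} {a b : ℝ}
    {σ : EuclideanSpace ℝ (Fin N)} (h : ∀ r, r ∉ Icc a b → u r σ = 0) {r : ℝ}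
    (hr : r ∉ Icc a b) : radGrad N u r σ = 0 := by
  have : (fun s => u s σ) =ᶠ[nhds r] fun _ => 0 :=
    Filter.eventually_of_mem (isClosed_Icc.isOpen_compl.mem_nhds hr) h
  rw [radGrad, this.deriv_eq, deriv_const]

theorem sinh_le_mul_cosh {r : ℝ} (hr : 0 ≤ r) : sinh r ≤ r * cosh r := by
  have hd : ∀ x : ℝ, HasDerivAt (fun x => x * cosh x - sinh x) (x * sinh x) x := fun x =>
    (((hasDerivAt_id x).mul (hasDerivAt_cosh x)).sub (hasDerivAt_sinh x)).congr_deriv (by simp)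
  have hm : MonotoneOn (fun x => x * cosh x - sinh x) (Ici 0) := by
    refine monotoneOn_of_deriv_nonneg (convex_Ici 0)
      (fun x _ => (hd x).continuousAt.continuousWithinAt)
      (fun x _ => (hd x).differentiableAt.differentiableWithinAt) fun x hx => ?_
    rw [interior_Ici] at hx
    rw [(hd x).deriv]
    exact mul_nonneg hx.le (sinh_nonneg_iff.2 hx.le)
  have := hm self_mem_Ici hr hr
  simp only [zero_mul, sinh_zero, sub_zero] at this
  linarith

/-- The pointwise completion of squares behind the weighted radial Rellich inequality: up to the
factor `r ^ (-α) * sinh r ^ n`, the right-hand side is a lower-order term plus a derivative. -/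
theorem rellich_pointwise {n α r c : ℝ} (hα : 0 ≤ α) (hn : 2 ≤ n) (hr : 0 < r) (hc : 1 ≤ r * c)
    {l : ℝ} (hl : l = (n - 1 - α) * (n - 1 + α) / 4) (hl0 : 0 ≤ l) (y y' y'' : ℝ) :
    l ^ 2 * (y ^ 2 / r ^ 2) + l * n * y ^ 2
        + l * n * (n - 2 - 2 * α) / 2 * ((r * c - 1) / r ^ 2 * y ^ 2)
        - l * (2 * y' ^ 2 + 2 * y * y'' + (n * (1 - c ^ 2) + 1 / r ^ 2) * y ^ 2
          + 2 * (n * c - 1 / r) * y * y'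
          + (n * c - α / r) * (2 * y * y' + (n * c - 1 / r) * y ^ 2))
      ≤ (y'' + n * c * y') ^ 2 * r ^ 2 := by
  have hci : 1 / r ≤ c := by rwa [div_le_iff₀' hr]
  have hc0 : 0 ≤ c := (one_div_pos.2 hr).le.trans hci
  have h1 : 0 ≤ n * (n - 2) / 4 * (c * (c - 1 / r)) := by
    have : 0 ≤ n - 2 := by linarith
    have : 0 ≤ c - 1 / r := by linarith
    positivity
  have h2 : 0 ≤ n * α / 2 * ((r * c - 1) / r ^ 2) := by
    have : 0 ≤ r * c - 1 := by linarith
    positivity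
  have h3 : 0 ≤ ((y'' + n * c * y') * r + l * y / r) ^ 2
      + 2 * l * (y' + (n * c - (1 + α) / r) / 2 * y) ^ 2
      + 2 * l * y ^ 2 * (n * (n - 2) / 4 * (c * (c - 1 / r))
        + n * α / 2 * ((r * c - 1) / r ^ 2)) := by positivity
  have h4 : l ^ 2 * (y ^ 2 / r ^ 2) = l * ((n - 1 - α) * (n - 1 + α) / 4) * (y ^ 2 / r ^ 2) := by
    rw [← hl]; ring
  refine le_of_sub_nonneg (h3.trans_eq ?_)
  rw [← sub_eq_zero]
  have h5 : ((y'' + n * c * y') * r + l * y / r) ^ 2 = (y'' + n * c * y') ^ 2 * r ^ 2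
      + 2 * (y'' + n * c * y') * l * y + l ^ 2 * (y ^ 2 / r ^ 2) := by
    field_simp; ring
  rw [h5, h4]
  field_simp
  ring

theorem hasDerivAt_rellich_boundary_term {α r : ℝ} (hr : 0 < r) {m : ℕ} {n : ℝ} (hm : (m : ℝ) = n)
    (l : ℝ) {f f' : ℝ → ℝ} {y'' : ℝ} (hf : HasDerivAt f (f' r) r) (hf' : HasDerivAt f' y'' r) :
    HasDerivAt (fun s => -l * (2 * f s * f' s + (n * (cosh s / sinh s) - 1 / s) * f s ^ 2)
        * (s ^ (-α) * sinh s ^ m))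
      (-l * (2 * f' r ^ 2 + 2 * f r * y'' + (n * (1 - (cosh r / sinh r) ^ 2) + 1 / r ^ 2) * f r ^ 2
          + 2 * (n * (cosh r / sinh r) - 1 / r) * f r * f' r
          + (n * (cosh r / sinh r) - α / r)
            * (2 * f r * f' r + (n * (cosh r / sinh r) - 1 / r) * f r ^ 2))
        * (r ^ (-α) * sinh r ^ m)) r := by
  have hs : sinh r ≠ 0 := (sinh_pos_iff.2 hr).ne'
  have hcoth : HasDerivAt (fun s => cosh s / sinh s) (1 - (cosh r / sinh r) ^ 2) r :=
    ((hasDerivAt_cosh r).div (hasDerivAt_sinh r) hs).congr_deriv (by field_simp)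
  have hinv : HasDerivAt (fun s : ℝ => 1 / s) (-(1 / r ^ 2)) r := by
    simpa using hasDerivAt_inv hr.ne'
  have hpow : HasDerivAt (fun s : ℝ => s ^ (-α)) (-α / r * r ^ (-α)) r :=
    (hasDerivAt_rpow_const (Or.inl hr.ne')).congr_deriv (by
      rw [rpow_sub_one hr.ne']; ring)
  have hsinh : HasDerivAt (fun s => sinh s ^ m) (n * (cosh r / sinh r) * sinh r ^ m) r :=
    ((hasDerivAt_sinh r).pow m).congr_deriv (by
      rcases m with _ | k
      · simp at hm; simp [← hm]
      · rw [hm, Nat.add_sub_cancel]; field_simp; ring)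
  have h := ((((hf.const_mul 2).mul hf').add (((hcoth.const_mul n).sub hinv).mul (hf.pow 2))).const_mul
    (-l)).mul (hpow.mul hsinh)
  refine h.congr_deriv ?_
  simp only [Pi.mul_apply, Pi.add_apply, Pi.sub_apply, Pi.pow_apply]
  push_cast
  ring

theorem linear_combination_setIntegral_le {X : Type*} [MeasurableSpace X] {μ : Measure X}
    {S : Set X} (hS : MeasurableSet S) {f g h k : X → ℝ} (hf : IntegrableOn f S μ)
    (hg : IntegrableOn g S μ) (hh : IntegrableOn h S μ) (hk : IntegrableOn k S μ) {c d e : ℝ}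
    (hle : ∀ x ∈ S, c * f x + d * g x + e * h x ≤ k x) :
    c * (∫ x in S, f x ∂μ) + d * (∫ x in S, g x ∂μ) + e * (∫ x in S, h x ∂μ)
      ≤ ∫ x in S, k x ∂μ := by
  have hfg : IntegrableOn (fun x => c * f x + d * g x) S μ := (hf.const_mul c).add (hg.const_mul d)
  rw [← integral_const_mul, ← integral_const_mul, ← integral_const_mul,
    ← integral_add (hf.const_mul c) (hg.const_mul d), ← integral_add hfg (hh.const_mul e)]
  exact setIntegral_mono_on (hfg.add (hh.const_mul e)) hk hS hle

/-- Weighted Rellich inequality with radial Laplacian and remainder terms on `ℍ^N`,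
where `g(r) = (r coth r - 1)/r²`. -/
theorem weighted_radial_rellich_with_remainder (N : ℕ) (α : ℝ) (hα : 0 < α)
    (hN : max (α + 2) (2 * α - 3) < (N : ℝ))
    (u : ℝ → EuclideanSpace ℝ (Fin N) → ℝ) (hu : IsCcAway N u) :
    hypInt N (fun r σ => (radLap N u r σ) ^ 2 / r ^ (α - 2)) ≥
      (((N : ℝ) - 2 - α) ^ 2 * ((N : ℝ) - 2 + α) ^ 2 / 16) *
          hypInt N (fun r σ => (u r σ) ^ 2 / r ^ (α + 2))
      + (((N : ℝ) - 2 - α) * ((N : ℝ) - 2 + α) * ((N : ℝ) - 1) / 4) *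
          hypInt N (fun r σ => (u r σ) ^ 2 / r ^ α)
      + (((N : ℝ) - 1) * ((N : ℝ) - 3 - 2 * α) * ((N : ℝ) - 2 - α) * ((N : ℝ) - 2 + α) / 8) *
          hypInt N (fun r σ =>
            ((r * (Real.cosh r / Real.sinh r) - 1) / r ^ 2) * (u r σ) ^ 2 / r ^ α) := by
  obtain ⟨hsmooth, a, b, ha, -, hzero⟩ := hu
  have hNα : α + 2 < N := (le_max_left _ _).trans_lt hN
  have hN2 : 2 < N := by exact_mod_cast (show (2 : ℝ) < N by linarith)
  have hN3 : (3 : ℝ) ≤ N := by exact_mod_cast hN2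
  have hm : ((N - 1 : ℕ) : ℝ) = (N : ℝ) - 1 := by
    rw [Nat.cast_sub (by omega), Nat.cast_one]
  have hμ : μH[(N : ℝ) - 1] (Metric.sphere (0 : EuclideanSpace ℝ (Fin N)) 1) ≠ ⊤ := by
    obtain ⟨k, rfl⟩ : ∃ k, N = k + 1 := ⟨N - 1, by omega⟩
    simpa using (hausdorffMeasure_sphere_lt_top k).ne
  have hS : IsCompact (Metric.sphere (0 : EuclideanSpace ℝ (Fin N)) 1) := isCompact_sphere _ _
  set v := radGrad N u
  set w := radGrad N v
  have hvs := contDiff_radGrad hsmooth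
  have hws := contDiff_radGrad hvs
  have hvzero : ∀ r, r ∉ Icc a b → ∀ σ ∈ Metric.sphere (0 : EuclideanSpace ℝ (Fin N)) 1,
      v r σ = 0 := fun r hr σ hσ => radGrad_eq_zero (fun s hs => hzero s hs σ hσ) hr
  have hwzero : ∀ r, r ∉ Icc a b → ∀ σ ∈ Metric.sphere (0 : EuclideanSpace ℝ (Fin N)) 1,
      w r σ = 0 := fun r hr σ hσ => radGrad_eq_zero (fun s hs => hvzero s hs σ hσ) hr
  have hlap : ∀ r σ, radLap N u r σ
      = w r σ + ((N : ℝ) - 1) * (cosh r / sinh r) * v r σ := fun _ _ => rfl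
  have hpos : ∀ p ∈ Ioi (0 : ℝ) ×ˢ (univ : Set (EuclideanSpace ℝ (Fin N))), 0 < p.1 :=
    fun p hp => hp.1
  have hrinv : ContinuousOn (fun p : ℝ × EuclideanSpace ℝ (Fin N) => p.1⁻¹) (Ioi 0 ×ˢ univ) :=
    continuousOn_fst.inv₀ fun p hp => (hpos p hp).ne'
  have hrinv2 : ContinuousOn (fun p : ℝ × EuclideanSpace ℝ (Fin N) => (p.1 ^ 2)⁻¹)
      (Ioi 0 ×ˢ univ) := (continuousOn_fst.pow 2).inv₀ fun p hp => (pow_pos (hpos p hp) 2).ne'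
  have hsinv : ContinuousOn (fun p : ℝ × EuclideanSpace ℝ (Fin N) => (sinh p.1)⁻¹)
      (Ioi 0 ×ˢ univ) :=
    (by fun_prop : Continuous fun p : ℝ × EuclideanSpace ℝ (Fin N) => sinh p.1).continuousOn.inv₀
      fun p hp => (sinh_pos_iff.2 (hpos p hp)).ne'
  have hpow : ∀ β : ℝ, ContinuousOn (fun p : ℝ × EuclideanSpace ℝ (Fin N) => p.1 ^ β)
      (Ioi 0 ×ˢ univ) := fun β => continuousOn_fst.rpow_const fun p hp => Or.inl (hpos p hp).ne'
  have hpinv : ∀ β : ℝ, ContinuousOn (fun p : ℝ × EuclideanSpace ℝ (Fin N) => (p.1 ^ β)⁻¹)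
      (Ioi 0 ×ˢ univ) := fun β => (hpow β).inv₀ fun p hp => (rpow_pos_of_pos (hpos p hp) β).ne'
  have hp0 := hpinv (α - 2)
  have hp1 := hpinv (α + 2)
  have hp2 := hpinv α
  have hp3 := hpow (-α)
  have huc : Continuous fun p : ℝ × EuclideanSpace ℝ (Fin N) => u p.1 p.2 := hsmooth.continuous
  have hvc : Continuous fun p : ℝ × EuclideanSpace ℝ (Fin N) => v p.1 p.2 := hvs.continuous
  have hwc : Continuous fun p : ℝ × EuclideanSpace ℝ (Fin N) => w p.1 p.2 := hws.continuous
  obtain ⟨hi0, hI0⟩ := integrableOn_and_integrableOn_integral hS hμ (b := b) ha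
    (F := fun r σ => radLap N u r σ ^ 2 / r ^ (α - 2) * sinh r ^ (N - 1))
    (by simp only [hlap, Function.uncurry_def, div_eq_mul_inv]; fun_prop)
    (fun r _ hr σ hσ => by simp [hlap, hvzero r hr σ hσ, hwzero r hr σ hσ])
  obtain ⟨hi1, hI1⟩ := integrableOn_and_integrableOn_integral hS hμ (b := b) ha
    (F := fun r σ => u r σ ^ 2 / r ^ (α + 2) * sinh r ^ (N - 1))
    (by simp only [Function.uncurry_def, div_eq_mul_inv]; fun_prop)
    (fun r _ hr σ hσ => by simp [hzero r hr σ hσ])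
  obtain ⟨hi2, hI2⟩ := integrableOn_and_integrableOn_integral hS hμ (b := b) ha
    (F := fun r σ => u r σ ^ 2 / r ^ α * sinh r ^ (N - 1))
    (by simp only [Function.uncurry_def, div_eq_mul_inv]; fun_prop)
    (fun r _ hr σ hσ => by simp [hzero r hr σ hσ])
  obtain ⟨hi3, hI3⟩ := integrableOn_and_integrableOn_integral hS hμ (b := b) ha
    (F := fun r σ => ((r * (cosh r / sinh r) - 1) / r ^ 2) * u r σ ^ 2 / r ^ α * sinh r ^ (N - 1))
    (by simp only [Function.uncurry_def, div_eq_mul_inv]; fun_prop)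
    (fun r _ hr σ hσ => by simp [hzero r hr σ hσ])
  set n : ℝ := (N : ℝ) - 1 with hn
  set l : ℝ := (n - 1 - α) * (n - 1 + α) / 4 with hl
  have hl0 : 0 ≤ l := by
    have h1 : 0 ≤ n - 1 - α := by linarith
    have h2 : 0 ≤ n - 1 + α := by linarith
    positivity
  let G' : ℝ → EuclideanSpace ℝ (Fin N) → ℝ := fun r σ =>
    -l * (2 * v r σ ^ 2 + 2 * u r σ * w r σ
        + (n * (1 - (cosh r / sinh r) ^ 2) + 1 / r ^ 2) * u r σ ^ 2
        + 2 * (n * (cosh r / sinh r) - 1 / r) * u r σ * v r σ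
        + (n * (cosh r / sinh r) - α / r)
          * (2 * u r σ * v r σ + (n * (cosh r / sinh r) - 1 / r) * u r σ ^ 2))
      * (r ^ (-α) * sinh r ^ (N - 1))
  obtain ⟨hiG, -⟩ := integrableOn_and_integrableOn_integral hS hμ (b := b) (F := G') ha
    (by simp only [G', Function.uncurry_def, div_eq_mul_inv]; fun_prop)
    (fun r _ hr σ hσ => by simp [G', hzero r hr σ hσ, hvzero r hr σ hσ])
  have hG : ∀ σ ∈ Metric.sphere (0 : EuclideanSpace ℝ (Fin N)) 1,
      ∫ r in Ioi 0, G' r σ = 0 := by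
    intro σ hσ
    let G : ℝ → ℝ := fun s => -l * (2 * u s σ * v s σ
      + (n * (cosh s / sinh s) - 1 / s) * u s σ ^ 2) * (s ^ (-α) * sinh s ^ (N - 1))
    have hGzero : ∀ r, r ∉ Icc a b → G r = 0 := fun r hr => by simp [G, hzero r hr σ hσ]
    have hG0 : G =ᶠ[nhds 0] fun _ => 0 :=
      Filter.eventually_of_mem (isClosed_Icc.isOpen_compl.mem_nhds fun h => ha.not_ge h.1) hGzero
    have hGtop : Filter.Tendsto G Filter.atTop (nhds 0) :=
      tendsto_const_nhds.congr' <| (Filter.eventually_gt_atTop b).mono fun r hr =>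
        (hGzero r fun h => hr.not_ge h.2).symm
    rw [integral_Ioi_of_hasDerivAt_of_tendsto (f := G)
      (continuousAt_const.congr hG0.symm).continuousWithinAt
      (fun r hr => hasDerivAt_rellich_boundary_term hr hm l (hasDerivAt_radGrad hsmooth r σ)
        (hasDerivAt_radGrad hvs r σ)) (hiG σ hσ) hGtop, hG0.eq_of_nhds, sub_zero]
  refine linear_combination_setIntegral_le hS.measurableSet hI1 hI2 hI3 hI0 fun σ hσ => ?_
  have h := integral_sub (hi0 σ hσ) (hiG σ hσ)
  rw [hG σ hσ, sub_zero] at h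
  rw [← h]
  refine linear_combination_setIntegral_le measurableSet_Ioi (hi1 σ hσ) (hi2 σ hσ) (hi3 σ hσ)
    ((hi0 σ hσ).sub (hiG σ hσ)) fun r hr => ?_
  have hr : 0 < r := hr
  have hs := sinh_pos_iff.2 hr
  have hc : 1 ≤ r * (cosh r / sinh r) := by
    rw [← mul_div_assoc, one_le_div hs]
    exact sinh_le_mul_cosh hr.le
  have hp := rpow_pos_of_pos hr α
  have key := mul_le_mul_of_nonneg_right
    (rellich_pointwise hα.le (by linarith) hr hc hl hl0 (u r σ) (v r σ) (w r σ))
    (by positivity : 0 ≤ r ^ (-α) * sinh r ^ (N - 1))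
  have hNn : (N : ℝ) = n + 1 := by rw [hn]; ring
  simp only [G', hlap, Pi.sub_apply]
  rw [rpow_neg hr.le] at key ⊢
  rw [rpow_sub hr, rpow_add hr, rpow_two, le_sub_iff_add_le]
  refine (le_of_eq ?_).trans (key.trans_eq ?_)
  · generalize cosh r / sinh r = c
    rw [hNn, hl]
    field_simp
    ring
  · generalize cosh r / sinh r = c
    field_simp
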